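/- arXiv:1201.6079 — 3 statements merged into one kernel-verified Lean document; each statement's English description precedes it below -/
import Mathlib

section
/- For every β ∈ ℤ^d the family (G^α_β)_{α∈ℤ^d} is absolutely summable and Σ_{α∈ℤ^d} G^α_β = 0, and for every α ∈ ℤ^d the family (G^α_β)_{β∈ℤ^d} is absolutely summable and Σ_{β∈ℤ^d} G^α_β = 0. -/
open MeasureTheory Set

noncomputable section

abbrev Ed (d : ℕ) := EuclideanSpace ℝ (Fin d)

def cell (d : ℕ) (dx : ℝ) (α : Fin d → ℤ) : Set (Ed d) :=
  {x | ∀ i, dx * (α i : ℝ) < x i ∧ x i < dx * (α i : ℝ) + dx}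

def ind (d : ℕ) (S : Set (Ed d)) : Ed d → ℝ :=
  S.indicator fun _ => 1

def gam (d : ℕ) (dx : ℝ) (μ : Measure (Ed d)) (l : Fin d) : ℝ :=
  - ∫ z in {z : Ed d | dx / 2 < ‖z‖ ∧ ‖z‖ ≤ 1}, z l ∂μ

def Dup (d : ℕ) (dx : ℝ) (μ : Measure (Ed d)) (l : Fin d) (φ : Ed d → ℝ) (x : Ed d) : ℝ :=
  if 0 < gam d dx μ l then (φ (x + EuclideanSpace.single l dx) - φ x) / dx
  else (φ x - φ (x - EuclideanSpace.single l dx)) / dx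

def Glow (d : ℕ) (dx : ℝ) (μ : Measure (Ed d)) (α β : Fin d → ℤ) : ℝ :=
  (dx ^ d)⁻¹ *
    ∫ x in cell d dx α, ∫ z in {z : Ed d | dx / 2 < ‖z‖},
      (ind d (cell d dx β) (x + z) - ind d (cell d dx β) x) ∂μ

def Gup (d : ℕ) (dx : ℝ) (μ : Measure (Ed d)) (α β : Fin d → ℤ) : ℝ :=
  (dx ^ d)⁻¹ *
    ∑ l : Fin d, gam d dx μ l * ∫ x in cell d dx α, Dup d dx μ l (ind d (cell d dx β)) x

def Gw (d : ℕ) (dx : ℝ) (μ : Measure (Ed d)) (α β : Fin d → ℤ) : ℝ :=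
  Glow d dx μ α β + Gup d dx μ α β

def GsplitLow (d : ℕ) (dx r : ℝ) (μ : Measure (Ed d)) (α β : Fin d → ℤ) : ℝ :=
  (dx ^ d)⁻¹ *
    ∫ x in cell d dx α, ∫ z in {z : Ed d | dx / 2 < ‖z‖ ∧ ‖z‖ ≤ r},
      (ind d (cell d dx β) (x + z) - ind d (cell d dx β) x) ∂μ

def GsplitHigh (d : ℕ) (dx r : ℝ) (μ : Measure (Ed d)) (α β : Fin d → ℤ) : ℝ :=
  (dx ^ d)⁻¹ *
      ∫ x in cell d dx α, ∫ z in {z : Ed d | r < ‖z‖},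
        (ind d (cell d dx β) (x + z) - ind d (cell d dx β) x) ∂μ
    + Gup d dx μ α β

def Aok (A : ℝ → ℝ) (LA : ℝ) : Prop :=
  Monotone A ∧ (∀ a b : ℝ, |A a - A b| ≤ LA * |a - b|) ∧ A 0 = 0

def SolvesImplicitStep (d : ℕ) (dx : ℝ) (μ : Measure (Ed d)) (A : ℝ → ℝ) (dt : ℝ)
    (u h : (Fin d → ℤ) → ℝ) : Prop :=
  ∀ α, Summable (fun β => Gw d dx μ α β * A (u β)) ∧
    u α - dt * ∑' β, Gw d dx μ α β * A (u β) = h α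

def Fractional (d : ℕ) (μ : Measure (Ed d)) (lam clam : ℝ) : Prop :=
  ∀ B : Set (Ed d), MeasurableSet B → B ⊆ {z : Ed d | 0 < ‖z‖ ∧ ‖z‖ < 1} →
    μ B ≤ ∫⁻ z in B, ENNReal.ofReal (clam * ‖z‖ ^ (-(d : ℝ) - lam))

def Lhat (d : ℕ) (dx : ℝ) (μ : Measure (Ed d)) (w : Ed d → ℝ) (x : Ed d) : ℝ :=
  (∫ z in {z : Ed d | dx / 2 < ‖z‖}, (w (x + z) - w x) ∂μ) +
    ∑ l : Fin d, gam d dx μ l * Dup d dx μ l w x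

def Ubar (d : ℕ) (dx : ℝ) (U : (Fin d → ℤ) → ℝ) (x : Ed d) : ℝ :=
  ∑' α : Fin d → ℤ, U α * ind d (cell d dx α) x

def cellAvg (d : ℕ) (dx : ℝ) (w : Ed d → ℝ) (x : Ed d) : ℝ :=
  ∑' α : Fin d → ℤ, Set.indicator (cell d dx α)
    (fun _ => (dx ^ d)⁻¹ * ∫ y in cell d dx α, w y) x


theorem measurableSet_cell (d : ℕ) (dx : ℝ) (α : Fin d → ℤ) : MeasurableSet (cell d dx α) := by
  have h : cell d dx α =
      ⋂ i, {x : Ed d | dx * (α i : ℝ) < x i} ∩ {x : Ed d | x i < dx * (α i : ℝ) + dx} := by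
    ext x
    simp [cell]
  rw [h]
  exact MeasurableSet.iInter fun i =>
    (measurableSet_lt (by fun_prop) (by fun_prop)).inter
      (measurableSet_lt (by fun_prop) (by fun_prop))

theorem volume_cell_lt_top (d : ℕ) (dx : ℝ) (α : Fin d → ℤ) : volume (cell d dx α) < ⊤ := by
  have h : cell d dx α = (WithLp.ofLp : Ed d → Fin d → ℝ) ⁻¹'
      (univ.pi fun i => Ioo (dx * (α i : ℝ)) (dx * (α i : ℝ) + dx)) := by
    ext x
    simp [cell]
  rw [h, (PiLp.volume_preserving_ofLp (Fin d)).measure_preimage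
    (MeasurableSet.univ_pi fun i => measurableSet_Ioo).nullMeasurableSet, Real.volume_pi_Ioo]
  exact ENNReal.prod_lt_top fun i _ => ENNReal.ofReal_lt_top

theorem floor_eq_of_mem_cell {d : ℕ} {dx : ℝ} (hdx : 0 < dx) {α : Fin d → ℤ} {x : Ed d}
    (hx : x ∈ cell d dx α) (i : Fin d) : ⌊x i / dx⌋ = α i := by
  rw [Int.floor_eq_iff, le_div_iff₀ hdx, div_lt_iff₀ hdx]
  constructor <;> nlinarith [(hx i).1, (hx i).2]

theorem pairwise_disjoint_cell (d : ℕ) {dx : ℝ} (hdx : 0 < dx) :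
    Pairwise (Function.onFun Disjoint (cell d dx)) := by
  intro α β hαβ
  refine Set.disjoint_left.2 fun x hα hβ => hαβ (funext fun i => ?_)
  rw [← floor_eq_of_mem_cell hdx hα i, floor_eq_of_mem_cell hdx hβ i]

theorem volume_hyperplane (d : ℕ) (i : Fin d) (t : ℝ) : volume {x : Ed d | x i = t} = 0 := by
  have h : {x : Ed d | x i = t} =
      (WithLp.ofLp : Ed d → Fin d → ℝ) ⁻¹' {y : Fin d → ℝ | y i = t} := rfl
  rw [h, (PiLp.volume_preserving_ofLp (Fin d)).measure_preimage
    (measurableSet_eq_fun (by fun_prop) (by fun_prop)).nullMeasurableSet]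
  exact Measure.pi_hyperplane (fun _ : Fin d => (volume : Measure ℝ)) i t

theorem volume_compl_iUnion_cell (d : ℕ) {dx : ℝ} (hdx : 0 < dx) :
    volume (⋃ α, cell d dx α)ᶜ = 0 := by
  refine measure_mono_null (t := ⋃ i : Fin d, ⋃ n : ℤ, {x : Ed d | x i = dx * (n : ℝ)}) ?_ ?_
  · intro x hx
    by_contra hne
    simp only [mem_iUnion, mem_ofPred_eq, not_exists] at hne
    refine hx (mem_iUnion.2 ⟨fun i => ⌊x i / dx⌋, fun i => ?_⟩)
    have h1 := Int.floor_le (x i / dx)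
    have h2 := Int.lt_floor_add_one (x i / dx)
    rw [le_div_iff₀ hdx] at h1
    rw [div_lt_iff₀ hdx] at h2
    refine ⟨lt_of_le_of_ne (by linarith) fun h => hne i _ h.symm, by linarith⟩
  · exact measure_iUnion_null fun i => measure_iUnion_null fun n => volume_hyperplane d i _

theorem hasSum_measureReal_inter {ι X : Type*} [Countable ι] [MeasurableSpace X] (M : Measure X)
    (A : ι → Set X) (hA : ∀ i, MeasurableSet (A i)) (hd : Pairwise (Function.onFun Disjoint A))
    (hU : M (⋃ i, A i)ᶜ = 0) (E : Set X) (hE : M E ≠ ⊤) :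
    HasSum (fun i => M.real (A i ∩ E)) (M.real E) := by
  have h : M E = ∑' i, M (A i ∩ E) := by
    have h1 := measure_iUnion hd hA (μ := M.restrict E)
    simp only [Measure.restrict_apply (hA _)] at h1
    rw [← h1, Measure.restrict_apply (MeasurableSet.iUnion hA), inter_comm]
    exact (measure_inter_conull hU).symm
  simp only [Measure.real]
  rw [h, ENNReal.tsum_toReal_eq fun i => measure_ne_top_of_subset inter_subset_right hE]
  exact (ENNReal.summable_toReal (h ▸ hE)).hasSum

theorem prod_add_preimage {E : Type*} [AddGroup E] [MeasurableSpace E] [MeasurableAdd₂ E]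
    (m ν : Measure E) [SFinite m] [SFinite ν] [m.IsAddRightInvariant]
    {T : Set E} (hT : MeasurableSet T) :
    m.prod ν {p | p.1 + p.2 ∈ T} = m T * ν univ := by
  have hm : MeasurableSet {p : E × E | p.1 + p.2 ∈ T} := (measurable_fst.add measurable_snd) hT
  rw [Measure.prod_apply_symm hm]
  have h : ∀ z : E, m ((fun x => (x, z)) ⁻¹' {p : E × E | p.1 + p.2 ∈ T}) = m T :=
    fun z => measure_preimage_add_right m z T
  rw [lintegral_congr h, lintegral_const]

/-- The mass transported from the cell `α` to the cell `β` by a jump distributed along `ν`. -/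
def cellTransfer (d : ℕ) (dx : ℝ) (ν : Measure (Ed d)) (α β : Fin d → ℤ) : ℝ :=
  ∫ x in cell d dx α, ∫ z, ind d (cell d dx β) (x + z) ∂ν

theorem measurable_ind {d : ℕ} {S : Set (Ed d)} (hS : MeasurableSet S) : Measurable (ind d S) :=
  measurable_const.indicator hS

theorem norm_ind_le (d : ℕ) (S : Set (Ed d)) (x : Ed d) : ‖ind d S x‖ ≤ 1 := by
  by_cases h : x ∈ S <;> simp [ind, h]

theorem integrable_ind_add (d : ℕ) (dx : ℝ) (m ν : Measure (Ed d)) [IsFiniteMeasure m]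
    [IsFiniteMeasure ν] (β : Fin d → ℤ) :
    Integrable (fun p : Ed d × Ed d => ind d (cell d dx β) (p.1 + p.2)) (m.prod ν) :=
  Integrable.of_bound ((measurable_ind (measurableSet_cell d dx β)).comp
    (measurable_fst.add measurable_snd)).aestronglyMeasurable 1
    (Filter.Eventually.of_forall fun _ => norm_ind_le _ _ _)

theorem integrableOn_ind_add (d : ℕ) (dx : ℝ) (α β : Fin d → ℤ) (v : Ed d) :
    IntegrableOn (fun x => ind d (cell d dx β) (x + v)) (cell d dx α) :=
  IntegrableOn.of_bound (volume_cell_lt_top d dx α)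
    ((measurable_ind (measurableSet_cell d dx β)).comp
      (measurable_id.add_const v)).aestronglyMeasurable 1
    (Filter.Eventually.of_forall fun _ => norm_ind_le _ _ _)

theorem cellTransfer_eq_measureReal (d : ℕ) (dx : ℝ) (ν : Measure (Ed d)) [IsFiniteMeasure ν]
    (α β : Fin d → ℤ) :
    cellTransfer d dx ν α β = (volume.prod ν).real
      (cell d dx α ×ˢ univ ∩ {p : Ed d × Ed d | p.1 + p.2 ∈ cell d dx β}) := by
  have : IsFiniteMeasure (volume.restrict (cell d dx α)) :=
    ⟨by simpa using volume_cell_lt_top d dx α⟩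
  have hm : MeasurableSet {p : Ed d × Ed d | p.1 + p.2 ∈ cell d dx β} :=
    (measurable_fst.add measurable_snd) (measurableSet_cell d dx β)
  rw [cellTransfer, ← integral_prod _ (integrable_ind_add d dx _ ν β)]
  have h1 : (fun p : Ed d × Ed d => ind d (cell d dx β) (p.1 + p.2)) =
      {p : Ed d × Ed d | p.1 + p.2 ∈ cell d dx β}.indicator fun _ => 1 := rfl
  have h2 : (volume.restrict (cell d dx α)).prod ν =
      (volume.prod ν).restrict (cell d dx α ×ˢ univ) := by
    rw [← Measure.prod_restrict, Measure.restrict_univ]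
  rw [h1, integral_indicator_const _ hm, h2, smul_eq_mul, mul_one, Measure.real,
    Measure.restrict_apply hm, inter_comm, Measure.real]

theorem hasSum_cellTransfer_source (d : ℕ) {dx : ℝ} (hdx : 0 < dx) (ν : Measure (Ed d))
    [IsFiniteMeasure ν] (β : Fin d → ℤ) :
    HasSum (fun α => cellTransfer d dx ν α β) (volume.real (cell d dx β) * ν.real univ) := by
  have hE := prod_add_preimage volume ν (measurableSet_cell d dx β)
  have h := hasSum_measureReal_inter (volume.prod ν) (fun α => cell d dx α ×ˢ univ)
    (fun α => (measurableSet_cell d dx α).prod MeasurableSet.univ)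
    (fun α β hαβ => Set.disjoint_prod.2 (Or.inl (pairwise_disjoint_cell d hdx hαβ)))
    (by
      have h1 : (⋃ α, cell d dx α ×ˢ (univ : Set (Ed d)))ᶜ = (⋃ α, cell d dx α)ᶜ ×ˢ univ := by
        ext p
        simp
      rw [h1, Measure.prod_prod, volume_compl_iUnion_cell d hdx, zero_mul])
    {p : Ed d × Ed d | p.1 + p.2 ∈ cell d dx β}
    (by rw [hE]; exact ENNReal.mul_ne_top (volume_cell_lt_top d dx β).ne (measure_ne_top _ _))
  simp only [← cellTransfer_eq_measureReal] at h
  simpa only [Measure.real, hE, ENNReal.toReal_mul] using h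

theorem hasSum_cellTransfer_target (d : ℕ) {dx : ℝ} (hdx : 0 < dx) (ν : Measure (Ed d))
    [IsFiniteMeasure ν] (α : Fin d → ℤ) :
    HasSum (fun β => cellTransfer d dx ν α β) (volume.real (cell d dx α) * ν.real univ) := by
  have hE : (volume.prod ν) (cell d dx α ×ˢ univ) = volume (cell d dx α) * ν univ :=
    Measure.prod_prod _ _
  have h := hasSum_measureReal_inter (volume.prod ν)
    (fun β => {p : Ed d × Ed d | p.1 + p.2 ∈ cell d dx β})
    (fun β => (measurable_fst.add measurable_snd) (measurableSet_cell d dx β))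
    (fun α β hαβ => (pairwise_disjoint_cell d hdx hαβ).preimage _)
    (by
      have h1 : (⋃ β, {p : Ed d × Ed d | p.1 + p.2 ∈ cell d dx β})ᶜ =
          {p : Ed d × Ed d | p.1 + p.2 ∈ (⋃ β, cell d dx β)ᶜ} := by
        ext p
        simp
      rw [h1, prod_add_preimage volume ν
        (MeasurableSet.iUnion fun β => measurableSet_cell d dx β).compl,
        volume_compl_iUnion_cell d hdx, zero_mul])
    (cell d dx α ×ˢ univ)
    (by rw [hE]; exact ENNReal.mul_ne_top (volume_cell_lt_top d dx α).ne (measure_ne_top _ _))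
  simp only [inter_comm _ (cell d dx α ×ˢ univ), ← cellTransfer_eq_measureReal] at h
  simpa only [Measure.real, hE, ENNReal.toReal_mul] using h

theorem cellTransfer_dirac (d : ℕ) (dx : ℝ) (v : Ed d) (α β : Fin d → ℤ) :
    cellTransfer d dx (Measure.dirac v) α β =
      ∫ x in cell d dx α, ind d (cell d dx β) (x + v) := by
  simp [cellTransfer]

theorem Glow_eq (d : ℕ) (dx : ℝ) (μ : Measure (Ed d))
    [IsFiniteMeasure (μ.restrict {z : Ed d | dx / 2 < ‖z‖})] (α β : Fin d → ℤ) :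
    Glow d dx μ α β = (dx ^ d)⁻¹ *
      (cellTransfer d dx (μ.restrict {z : Ed d | dx / 2 < ‖z‖}) α β -
        (μ.restrict {z : Ed d | dx / 2 < ‖z‖}).real univ *
          cellTransfer d dx (Measure.dirac 0) α β) := by
  set ν := μ.restrict {z : Ed d | dx / 2 < ‖z‖} with hν
  have : IsFiniteMeasure (volume.restrict (cell d dx α)) :=
    ⟨by simpa using volume_cell_lt_top d dx α⟩
  have h1 : ∀ x : Ed d, ∫ z, (ind d (cell d dx β) (x + z) - ind d (cell d dx β) x) ∂ν =
      (∫ z, ind d (cell d dx β) (x + z) ∂ν) - ν.real univ * ind d (cell d dx β) x := by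
    intro x
    rw [integral_sub _ (integrable_const _), integral_const, smul_eq_mul]
    exact Integrable.of_bound ((measurable_ind (measurableSet_cell d dx β)).comp
      (measurable_id.const_add x)).aestronglyMeasurable 1
      (Filter.Eventually.of_forall fun _ => norm_ind_le _ _ _)
  have h0 : Integrable (ind d (cell d dx β)) (volume.restrict (cell d dx α)) := by
    simpa [IntegrableOn] using integrableOn_ind_add d dx α β 0
  rw [Glow, ← hν]
  simp only [h1]
  rw [integral_sub (integrable_ind_add d dx _ ν β).integral_prod_left (h0.const_mul _),
    integral_const_mul, cellTransfer_dirac]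
  simp only [add_zero, cellTransfer]

theorem setIntegral_Dup_eq (d : ℕ) (dx : ℝ) (μ : Measure (Ed d)) (l : Fin d) (α β : Fin d → ℤ) :
    ∫ x in cell d dx α, Dup d dx μ l (ind d (cell d dx β)) x =
      if 0 < gam d dx μ l then
        (cellTransfer d dx (Measure.dirac (EuclideanSpace.single l dx)) α β -
          cellTransfer d dx (Measure.dirac 0) α β) / dx
      else (cellTransfer d dx (Measure.dirac 0) α β -
          cellTransfer d dx (Measure.dirac (-EuclideanSpace.single l dx)) α β) / dx := by
  have h0 : IntegrableOn (fun x => ind d (cell d dx β) x) (cell d dx α) := by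
    simpa using integrableOn_ind_add d dx α β 0
  simp only [Dup, cellTransfer_dirac, add_zero, sub_eq_add_neg _ (EuclideanSpace.single l dx)]
  split_ifs
  · rw [integral_div, integral_sub (integrableOn_ind_add d dx α β _) h0]
  · rw [integral_div, integral_sub h0 (integrableOn_ind_add d dx α β _)]

/-- Vanishing of the sum of the weights along any family of cell pairs for which the total
transfer of a finite measure is proportional to its mass. -/
theorem hasSum_Gw_zero {ι : Type*} (d : ℕ) (dx : ℝ) (μ : Measure (Ed d))
    [IsFiniteMeasure (μ.restrict {z : Ed d | dx / 2 < ‖z‖})] (a b : ι → Fin d → ℤ) (V : ℝ)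
    (h : ∀ ν : Measure (Ed d), IsFiniteMeasure ν →
      HasSum (fun i => cellTransfer d dx ν (a i) (b i)) (V * ν.real univ)) :
    HasSum (fun i => Gw d dx μ (a i) (b i)) 0 := by
  have hdirac : ∀ v : Ed d,
      HasSum (fun i => cellTransfer d dx (Measure.dirac v) (a i) (b i)) V := fun v => by
    simpa using h (Measure.dirac v) inferInstance
  have hlow : HasSum (fun i => Glow d dx μ (a i) (b i)) 0 := by
    simp only [Glow_eq]
    have := ((h (μ.restrict {z : Ed d | dx / 2 < ‖z‖}) inferInstance).sub ((hdirac 0).mul_left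
      ((μ.restrict {z : Ed d | dx / 2 < ‖z‖}).real univ))).mul_left (dx ^ d)⁻¹
    rwa [mul_comm V, sub_self, mul_zero] at this
  have hup : HasSum (fun i => Gup d dx μ (a i) (b i)) 0 := by
    have hl : ∀ l : Fin d, HasSum (fun i => gam d dx μ l *
        ∫ x in cell d dx (a i), Dup d dx μ l (ind d (cell d dx (b i))) x) 0 := by
      intro l
      simp only [setIntegral_Dup_eq]
      split_ifs
      · simpa using (((hdirac (EuclideanSpace.single l dx)).sub (hdirac 0)).div_const dx).mul_left
          (gam d dx μ l)
      · simpa using (((hdirac 0).sub (hdirac (-EuclideanSpace.single l dx))).div_const dx).mul_left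
          (gam d dx μ l)
    simpa [Gup] using (hasSum_sum fun l (_ : l ∈ Finset.univ) => hl l).mul_left (dx ^ d)⁻¹
  simpa [Gw] using hlow.add hup

theorem measure_norm_gt_lt_top {E : Type*} [NormedAddCommGroup E] [MeasurableSpace E]
    [BorelSpace E] {μ : Measure E} {r : ℝ} (hr : 0 < r)
    (hμ : ∫⁻ z, ENNReal.ofReal (min (‖z‖ ^ 2) 1) ∂μ < ⊤) : μ {z | r < ‖z‖} < ⊤ := by
  have hc : 0 < min (r ^ 2) 1 := lt_min (by positivity) one_pos
  refine lt_of_le_of_lt (measure_mono (t := {z | ENNReal.ofReal (min (r ^ 2) 1) ≤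
    ENNReal.ofReal (min (‖z‖ ^ 2) 1)}) fun z (hz : r < ‖z‖) => ?_)
    (lt_of_le_of_lt (meas_ge_le_lintegral_div (by fun_prop) (ENNReal.ofReal_pos.2 hc |>.ne')
      ENNReal.ofReal_ne_top) (ENNReal.div_lt_top hμ.ne (ENNReal.ofReal_pos.2 hc |>.ne')))
  exact ENNReal.ofReal_le_ofReal (min_le_min_right _ (pow_le_pow_left₀ hr.le hz.le 2))

theorem stmt0 (d : ℕ) (hd : 1 ≤ d) (dx : ℝ) (hdx0 : 0 < dx) (hdx1 : dx < 1)
    (μ : Measure (Ed d)) (hμ0 : μ {0} = 0)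
    (hμfin : ∫⁻ z, ENNReal.ofReal (min (‖z‖ ^ 2) 1) ∂μ < ⊤) :
    (∀ β : Fin d → ℤ,
      Summable (fun α : Fin d → ℤ => Gw d dx μ α β) ∧ ∑' α : Fin d → ℤ, Gw d dx μ α β = 0) ∧
    (∀ α : Fin d → ℤ,
      Summable (fun β : Fin d → ℤ => Gw d dx μ α β) ∧ ∑' β : Fin d → ℤ, Gw d dx μ α β = 0) := by
  have : IsFiniteMeasure (μ.restrict {z : Ed d | dx / 2 < ‖z‖}) :=
    ⟨by simpa using measure_norm_gt_lt_top (half_pos hdx0) hμfin⟩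
  refine ⟨fun β => ?_, fun α => ?_⟩
  · have h := hasSum_Gw_zero d dx μ (fun α => α) (fun _ => β) (volume.real (cell d dx β))
      fun ν _ => hasSum_cellTransfer_source d hdx0 ν β
    exact ⟨h.summable, h.tsum_eq⟩
  · have h := hasSum_Gw_zero d dx μ (fun _ => α) (fun β => β) (volume.real (cell d dx α))
      fun ν _ => hasSum_cellTransfer_target d hdx0 ν α
    exact ⟨h.summable, h.tsum_eq⟩
end
end

section
/- There exists a constant c̄ > 0, depending only on d and μ, such that for every mesh size Δx ∈ (0,1) and every β ∈ ℤ^d one has G^β_β ≥ −c̄/Δx²; if in addition ∫_{ℝ^d} min(|z|,1) dμ(z) < ∞, then one has the stronger bound G^β_β ≥ −c̄/Δx. -/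
open MeasureTheory Set

noncomputable section

theorem measureReal_cell_le (d : ℕ) {dx : ℝ} (hdx : 0 < dx) (α : Fin d → ℤ) :
    volume (cell d dx α) < ⊤ ∧ volume.real (cell d dx α) ≤ dx ^ d := by
  have hcell : cell d dx α = (MeasurableEquiv.toLp 2 (Fin d → ℝ)).symm ⁻¹'
      (Set.univ.pi fun i => Ioo (dx * (α i : ℝ)) (dx * (α i : ℝ) + dx)) := by
    ext x
    simp [cell]
  have hvol : volume (cell d dx α) = ENNReal.ofReal dx ^ d := by
    rw [hcell, (EuclideanSpace.volume_preserving_symm_measurableEquiv_toLp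
      (Fin d)).measure_preimage_equiv, Real.volume_pi_Ioo]
    simp
  constructor
  · rw [hvol]
    exact ENNReal.pow_lt_top ENNReal.ofReal_lt_top
  · rw [Measure.real, hvol, ENNReal.toReal_pow, ENNReal.toReal_ofReal hdx.le]

theorem abs_ind_sub_ind_le (d : ℕ) (S : Set (Ed d)) (x y : Ed d) :
    |ind d S x - ind d S y| ≤ 1 := by
  unfold ind
  by_cases hx : x ∈ S <;> by_cases hy : y ∈ S <;> simp [hx, hy]

theorem abs_Dup_ind_le (d : ℕ) {dx : ℝ} (hdx : 0 < dx) (μ : Measure (Ed d)) (l : Fin d)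
    (S : Set (Ed d)) (x : Ed d) : |Dup d dx μ l (ind d S) x| ≤ 1 / dx := by
  unfold Dup
  split_ifs <;> rw [abs_div, abs_of_pos hdx] <;> gcongr <;> exact abs_ind_sub_ind_le d S _ _

/-- An integral over a cell, normalized by the cell volume, is at most any bound of the
integrand. -/
theorem abs_cell_average_le (d : ℕ) {dx : ℝ} (hdx : 0 < dx) (α : Fin d → ℤ) {f : Ed d → ℝ}
    {C : ℝ} (hC : 0 ≤ C) (hf : ∀ x, |f x| ≤ C) :
    (dx ^ d)⁻¹ * |∫ x in cell d dx α, f x| ≤ C := by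
  obtain ⟨hfin, hle⟩ := measureReal_cell_le d hdx α
  have h := norm_setIntegral_le_of_norm_le_const (f := f) hfin fun x _ => hf x
  rw [inv_mul_le_iff₀ (by positivity), mul_comm]
  exact h.trans (by gcongr)

theorem abs_Glow_le (d : ℕ) {dx : ℝ} (hdx : 0 < dx) (μ : Measure (Ed d)) (α β : Fin d → ℤ)
    (hfin : μ {z : Ed d | dx / 2 < ‖z‖} < ⊤) :
    |Glow d dx μ α β| ≤ μ.real {z : Ed d | dx / 2 < ‖z‖} := by
  unfold Glow
  rw [abs_mul, abs_of_pos (by positivity)]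
  refine abs_cell_average_le d hdx α measureReal_nonneg fun x => ?_
  have h := norm_setIntegral_le_of_norm_le_const (C := 1) hfin
    (f := fun z => ind d (cell d dx β) (x + z) - ind d (cell d dx β) x)
    fun z _ => abs_ind_sub_ind_le d _ _ _
  simpa using h

theorem abs_Gup_le (d : ℕ) {dx : ℝ} (hdx : 0 < dx) (μ : Measure (Ed d)) (α β : Fin d → ℤ) :
    |Gup d dx μ α β| ≤ ∑ l : Fin d, |gam d dx μ l| * (1 / dx) := by
  unfold Gup
  rw [abs_mul, abs_of_pos (by positivity)]
  calc _ ≤ (dx ^ d)⁻¹ * ∑ l : Fin d, |gam d dx μ l| *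
        |∫ x in cell d dx α, Dup d dx μ l (ind d (cell d dx β)) x| := by
        gcongr
        refine (Finset.abs_sum_le_sum_abs _ _).trans_eq ?_
        simp [abs_mul]
    _ = ∑ l : Fin d, |gam d dx μ l| * ((dx ^ d)⁻¹ *
        |∫ x in cell d dx α, Dup d dx μ l (ind d (cell d dx β)) x|) := by
        rw [Finset.mul_sum]
        exact Finset.sum_congr rfl fun l _ => by ring
    _ ≤ _ := by
        gcongr with l
        exact abs_cell_average_le d hdx α (by positivity) fun x => abs_Dup_ind_le d hdx μ l _ x

/-- If `K * W` dominates `1` and `‖z‖ / dx` on the relevant sets, then `(d + 1) * K * ∫ W`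
bounds every weight. -/
theorem abs_Gw_le (d : ℕ) {dx : ℝ} (hdx : 0 < dx) (μ : Measure (Ed d)) (α β : Fin d → ℤ)
    {W : Ed d → ℝ} {K : ℝ} (hK : 0 ≤ K) (hW0 : ∀ z, 0 ≤ W z) (hW : Integrable W μ)
    (h1 : ∀ z, dx / 2 < ‖z‖ → 1 ≤ K * W z)
    (h2 : ∀ z, dx / 2 < ‖z‖ → ‖z‖ ≤ 1 → ‖z‖ ≤ dx * (K * W z)) :
    |Gw d dx μ α β| ≤ (d + 1) * (K * ∫ z, W z ∂μ) := by
  have hKW : Integrable (fun z => K * W z) μ := hW.const_mul K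
  have hsub : {z : Ed d | dx / 2 < ‖z‖} ⊆ {z | 1 ≤ K * W z} := fun z hz => h1 z hz
  have hge := hKW.measure_ge_lt_top zero_lt_one
  have hlow : |Glow d dx μ α β| ≤ K * ∫ z, W z ∂μ := by
    refine (abs_Glow_le d hdx μ α β ((measure_mono hsub).trans_lt hge)).trans ?_
    refine (measureReal_mono hsub hge.ne).trans ?_
    have := mul_meas_ge_le_integral_of_nonneg
      (Filter.Eventually.of_forall fun z => mul_nonneg hK (hW0 z)) hKW 1
    rwa [one_mul, integral_const_mul] at this
  have hgam (l : Fin d) : |gam d dx μ l| ≤ dx * (K * ∫ z, W z ∂μ) := by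
    have hS : MeasurableSet {z : Ed d | dx / 2 < ‖z‖ ∧ ‖z‖ ≤ 1} := by measurability
    have hdW : Integrable (fun z => dx * (K * W z)) μ := hKW.const_mul dx
    unfold gam
    rw [abs_neg, ← integral_const_mul, ← integral_const_mul]
    calc _ ≤ ∫ z in {z : Ed d | dx / 2 < ‖z‖ ∧ ‖z‖ ≤ 1}, dx * (K * W z) ∂μ := by
          refine norm_integral_le_of_norm_le (f := fun z : Ed d => z l) hdW.integrableOn
            ((ae_restrict_mem hS).mono fun z hz => ?_)
          exact (PiLp.norm_apply_le z l).trans (h2 z hz.1 hz.2)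
      _ ≤ _ := setIntegral_le_integral hdW (Filter.Eventually.of_forall fun z =>
          mul_nonneg hdx.le (mul_nonneg hK (hW0 z)))
  have hup : |Gup d dx μ α β| ≤ d * (K * ∫ z, W z ∂μ) := by
    refine (abs_Gup_le d hdx μ α β).trans ?_
    calc _ ≤ ∑ _l : Fin d, K * ∫ z, W z ∂μ := by
          refine Finset.sum_le_sum fun l _ => ?_
          rw [mul_one_div, div_le_iff₀' hdx]
          exact hgam l
      _ = _ := by simp
  unfold Gw
  linarith [abs_add_le (Glow d dx μ α β) (Gup d dx μ α β)]

theorem integrable_of_lintegral_ofReal_lt_top {X : Type*} [MeasurableSpace X] {μ : Measure X}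
    {f : X → ℝ} (hf : AEStronglyMeasurable f μ) (h0 : ∀ x, 0 ≤ f x)
    (hfin : ∫⁻ x, ENNReal.ofReal (f x) ∂μ < ⊤) : Integrable f μ :=
  ⟨hf, (hasFiniteIntegral_iff_ofReal (Filter.Eventually.of_forall h0)).2 hfin⟩

theorem stmt3 (d : ℕ) (hd : 1 ≤ d)
    (μ : Measure (Ed d)) (hμ0 : μ {0} = 0)
    (hμfin : ∫⁻ z, ENNReal.ofReal (min (‖z‖ ^ 2) 1) ∂μ < ⊤) :
    ∃ c : ℝ, 0 < c ∧
      ∀ dx : ℝ, 0 < dx → dx < 1 → ∀ β : Fin d → ℤ,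
        (-(c / dx ^ 2) ≤ Gw d dx μ β β) ∧
        ((∫⁻ z, ENNReal.ofReal (min ‖z‖ 1) ∂μ < ⊤) → -(c / dx) ≤ Gw d dx μ β β) := by
  set I₂ := ∫ z, min (‖z‖ ^ 2) 1 ∂μ with hI₂
  set I₁ := ∫ z, min ‖z‖ 1 ∂μ with hI₁
  have hI₂0 : 0 ≤ I₂ := integral_nonneg fun z => by positivity
  have hI₁0 : 0 ≤ I₁ := integral_nonneg fun z => by positivity
  have hint₂ : Integrable (fun z : Ed d => min (‖z‖ ^ 2) 1) μ :=
    integrable_of_lintegral_ofReal_lt_top (by fun_prop) (fun z => by positivity) hμfin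
  have hd0 : (0 : ℝ) ≤ d := d.cast_nonneg
  refine ⟨(d + 1) * (4 * I₂ + 2 * I₁) + 1, by positivity, fun dx hdx hdx1 β => ⟨?_, fun hfin => ?_⟩⟩
  · have hG := abs_Gw_le d hdx μ β β (K := 4 / dx ^ 2) (by positivity)
      (fun z => by positivity) hint₂
      (fun z hz => by
        rw [div_mul_eq_mul_div, le_div_iff₀ (by positivity), one_mul]
        rcases min_cases (‖z‖ ^ 2) 1 with h | h <;> rw [h.1] <;> nlinarith)
      (fun z hz hz1 => by
        have hz0 := norm_nonneg z
        rw [min_eq_left (by nlinarith),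
          show dx * (4 / dx ^ 2 * ‖z‖ ^ 2) = 4 * ‖z‖ ^ 2 / dx by field_simp,
          le_div_iff₀ hdx]
        nlinarith)
    refine le_trans (neg_le_neg (hG.trans ?_)) (neg_abs_le _)
    rw [← hI₂, show (d + 1 : ℝ) * (4 / dx ^ 2 * I₂) = (d + 1) * (4 * I₂) / dx ^ 2 by ring]
    gcongr
    nlinarith [mul_nonneg hd0 hI₁0]
  · have hint₁ : Integrable (fun z : Ed d => min ‖z‖ 1) μ :=
      integrable_of_lintegral_ofReal_lt_top (by fun_prop) (fun z => by positivity) hfin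
    have hG := abs_Gw_le d hdx μ β β (K := 2 / dx) (by positivity)
      (fun z => by positivity) hint₁
      (fun z hz => by
        rw [div_mul_eq_mul_div, le_div_iff₀ hdx, one_mul]
        rcases min_cases ‖z‖ 1 with h | h <;> rw [h.1] <;> linarith)
      (fun z hz hz1 => by
        rw [min_eq_left hz1, show dx * (2 / dx * ‖z‖) = 2 * ‖z‖ by field_simp]
        linarith [norm_nonneg z])
    refine le_trans (neg_le_neg (hG.trans ?_)) (neg_abs_le _)
    rw [← hI₁, show (d + 1 : ℝ) * (2 / dx * I₁) = (d + 1) * (2 * I₁) / dx by ring]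
    gcongr
    nlinarith [mul_nonneg hd0 hI₂0]
end
end

section
/- (Discrete Kato inequality.) Let A : ℝ → ℝ be nondecreasing and let u, v : ℤ^d → ℝ be bounded sequences. Then for every α ∈ ℤ^d both sums below converge absolutely and sgn(u_α − v_α) · Σ_{β∈ℤ^d} G^α_β (A(u_β) − A(v_β)) ≤ Σ_{β∈ℤ^d} G^α_β |A(u_β) − A(v_β)|, where sgn(t) = 1 for t > 0, sgn(t) = −1 for t < 0, and sgn(0) = 0. -/
open MeasureTheory Set

noncomputable section

theorem eq_of_mem_cell {d : ℕ} {dx : ℝ} (hdx : 0 < dx) {α β : Fin d → ℤ} {x : Ed d}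
    (hα : x ∈ cell d dx α) (hβ : x ∈ cell d dx β) : α = β := by
  funext i
  obtain ⟨h1, h2⟩ := hα i
  obtain ⟨h3, h4⟩ := hβ i
  have h5 : (α i : ℝ) < β i + 1 := by
    refine lt_of_mul_lt_mul_left ?_ hdx.le
    linarith
  have h6 : (β i : ℝ) < α i + 1 := by
    refine lt_of_mul_lt_mul_left ?_ hdx.le
    linarith
  norm_cast at h5 h6
  omega

theorem measure_norm_gt_lt_top_s5 {d : ℕ} {r : ℝ} (hr0 : 0 < r) (hr1 : r ≤ 1)
    {μ : Measure (Ed d)} (hμ : ∫⁻ z, ENNReal.ofReal (min (‖z‖ ^ 2) 1) ∂μ < ⊤) :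
    μ {z : Ed d | r < ‖z‖} < ⊤ := by
  have hm : AEMeasurable (fun z : Ed d => ENNReal.ofReal (min (‖z‖ ^ 2) 1)) μ := by fun_prop
  have hε : ENNReal.ofReal (r ^ 2) ≠ 0 := by simpa using hr0.ne'
  refine lt_of_le_of_lt (measure_mono ?_)
    (lt_of_le_of_lt (meas_ge_le_lintegral_div hm hε ENNReal.ofReal_ne_top)
      (ENNReal.div_lt_top hμ.ne hε))
  intro z hz
  have hz' : r < ‖z‖ := hz
  refine ENNReal.ofReal_le_ofReal (le_min ?_ ?_) <;> nlinarith

theorem ind_nonneg (d : ℕ) (S : Set (Ed d)) (x : Ed d) : 0 ≤ ind d S x :=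
  indicator_nonneg (fun _ _ => zero_le_one) x

theorem ind_cell_eq_zero {d : ℕ} {dx : ℝ} (hdx : 0 < dx) {α β : Fin d → ℤ} (h : β ≠ α)
    {x : Ed d} (hx : x ∈ cell d dx α) : ind d (cell d dx β) x = 0 :=
  indicator_of_notMem (fun hβ => h (eq_of_mem_cell hdx hβ hx)) _

theorem ind_comp_eq {Ω : Type*} (d : ℕ) (S : Set (Ed d)) (f : Ω → Ed d) :
    (fun ω => ind d S (f ω)) = (f ⁻¹' S).indicator fun _ => (1 : ℝ) := rfl

section Integrals

variable {Ω : Type*} [MeasurableSpace Ω] (P : Measure Ω) [IsFiniteMeasure P]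

theorem integrable_ind_cell_comp {d : ℕ} (dx : ℝ) {f : Ω → Ed d} (hf : Measurable f)
    (β : Fin d → ℤ) : Integrable (fun ω => ind d (cell d dx β) (f ω)) P := by
  rw [ind_comp_eq]
  exact (integrable_const 1).indicator (hf (measurableSet_cell d dx β))

theorem summable_integral_ind_cell_comp {d : ℕ} {dx : ℝ} (hdx : 0 < dx) {f : Ω → Ed d}
    (hf : Measurable f) :
    Summable fun β : Fin d → ℤ => ∫ ω, ind d (cell d dx β) (f ω) ∂P := by
  have hm : ∀ β, MeasurableSet (f ⁻¹' cell d dx β) := fun β => hf (measurableSet_cell d dx β)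
  have hd : Pairwise (Function.onFun Disjoint fun β : Fin d → ℤ => f ⁻¹' cell d dx β) :=
    fun β γ hne => Set.disjoint_left.2 fun ω hβ hγ => hne (eq_of_mem_cell hdx hβ hγ)
  have hs : ∑' β : Fin d → ℤ, P (f ⁻¹' cell d dx β) ≠ ⊤ := by
    rw [← measure_iUnion hd hm]
    exact measure_ne_top P _
  refine (ENNReal.summable_toReal hs).congr fun β => ?_
  rw [ind_comp_eq, integral_indicator_const _ (hm β)]
  simp [Measure.real]

end Integrals

theorem summable_Glow {d : ℕ} {dx : ℝ} (hdx : 0 < dx) (μ : Measure (Ed d))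
    (hμ : μ {z : Ed d | dx / 2 < ‖z‖} < ⊤) (α : Fin d → ℤ) : Summable (Glow d dx μ α) := by
  have : IsFiniteMeasure (volume.restrict (cell d dx α)) :=
    isFiniteMeasure_restrict.2 (volume_cell_lt_top d dx α).ne
  have : IsFiniteMeasure (μ.restrict {z : Ed d | dx / 2 < ‖z‖}) :=
    isFiniteMeasure_restrict.2 hμ.ne
  set P := (volume.restrict (cell d dx α)).prod (μ.restrict {z : Ed d | dx / 2 < ‖z‖}) with hP
  have ha : Measurable fun p : Ed d × Ed d => p.1 + p.2 := by fun_prop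
  refine Summable.mul_left _ (((summable_integral_ind_cell_comp P hdx ha).sub
    (summable_integral_ind_cell_comp P hdx measurable_fst)).congr fun β => ?_)
  have h1 := integrable_ind_cell_comp P dx ha β
  have h2 := integrable_ind_cell_comp P dx measurable_fst β
  rw [← integral_sub h1 h2]
  exact integral_prod _ (h1.sub h2)

theorem summable_Gup {d : ℕ} {dx : ℝ} (hdx : 0 < dx) (μ : Measure (Ed d)) (α : Fin d → ℤ) :
    Summable (Gup d dx μ α) := by
  have : IsFiniteMeasure (volume.restrict (cell d dx α)) :=
    isFiniteMeasure_restrict.2 (volume_cell_lt_top d dx α).ne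
  set P := volume.restrict (cell d dx α) with hP
  refine Summable.mul_left _ (summable_sum fun l _ => Summable.mul_left _ ?_)
  have key : ∀ f g : Ed d → Ed d, Measurable f → Measurable g → Summable fun β : Fin d → ℤ =>
      ∫ x, (ind d (cell d dx β) (f x) - ind d (cell d dx β) (g x)) / dx ∂P := by
    intro f g hf hg
    refine (((summable_integral_ind_cell_comp P hdx hf).sub
      (summable_integral_ind_cell_comp P hdx hg)).div_const dx).congr fun β => ?_
    rw [integral_div, integral_sub (integrable_ind_cell_comp P dx hf β)
      (integrable_ind_cell_comp P dx hg β)]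
  unfold Dup
  split_ifs
  · exact key _ _ (by fun_prop) measurable_id
  · exact key _ _ measurable_id (by fun_prop)

theorem Gw_nonneg_of_ne {d : ℕ} {dx : ℝ} (hdx : 0 < dx) (μ : Measure (Ed d))
    {α β : Fin d → ℤ} (h : β ≠ α) : 0 ≤ Gw d dx μ α β := by
  have hm := measurableSet_cell d dx α
  refine add_nonneg (mul_nonneg (by positivity) ?_) (mul_nonneg (by positivity) ?_)
  · refine setIntegral_nonneg hm fun x hx => integral_nonneg fun z => ?_
    simpa [ind_cell_eq_zero hdx h hx] using ind_nonneg d (cell d dx β) (x + z)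
  · refine Finset.sum_nonneg fun l _ => ?_
    by_cases hl : 0 < gam d dx μ l
    · refine mul_nonneg hl.le (setIntegral_nonneg hm fun x hx => ?_)
      simp only [Dup, if_pos hl, ind_cell_eq_zero hdx h hx, sub_zero]
      exact div_nonneg (ind_nonneg d _ _) hdx.le
    · refine mul_nonneg_of_nonpos_of_nonpos (not_lt.1 hl)
        (setIntegral_nonpos hm fun x hx => ?_)
      simp only [Dup, if_neg hl, ind_cell_eq_zero hdx h hx, zero_sub]
      exact div_nonpos_of_nonpos_of_nonneg (neg_nonpos.2 (ind_nonneg d _ _)) hdx.le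

theorem sign_mul_le_abs (s t : ℝ) : Real.sign s * t ≤ |t| := by
  rcases Real.sign_apply_eq s with h | h | h <;> rw [h]
  · simpa using neg_le_abs t
  · simp
  · simpa using le_abs_self t

theorem Monotone.sign_sub_mul_sub {A : ℝ → ℝ} (hA : Monotone A) (a b : ℝ) :
    Real.sign (a - b) * (A a - A b) = |A a - A b| := by
  rcases lt_trichotomy a b with h | h | h
  · rw [Real.sign_of_neg (sub_neg.2 h), abs_of_nonpos (sub_nonpos.2 (hA h.le)), neg_one_mul]
  · simp [h]
  · rw [Real.sign_of_pos (sub_pos.2 h), abs_of_nonneg (sub_nonneg.2 (hA h.le)), one_mul]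

theorem Monotone.exists_abs_comp_le {ι : Type*} {A : ℝ → ℝ} (hA : Monotone A) {u : ι → ℝ}
    (hu : ∃ M : ℝ, ∀ i, |u i| ≤ M) : ∃ C : ℝ, ∀ i, |A (u i)| ≤ C := by
  obtain ⟨M, hM⟩ := hu
  refine ⟨max |A (-M)| |A M|, fun i => ?_⟩
  exact abs_le_max_abs_abs (hA (abs_le.1 (hM i)).1) (hA (abs_le.1 (hM i)).2)

theorem stmt5 (d : ℕ) (hd : 1 ≤ d) (dx : ℝ) (hdx0 : 0 < dx) (hdx1 : dx < 1)
    (μ : Measure (Ed d)) (hμ0 : μ {0} = 0)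
    (hμfin : ∫⁻ z, ENNReal.ofReal (min (‖z‖ ^ 2) 1) ∂μ < ⊤)
    (A : ℝ → ℝ) (hA : Monotone A)
    (u v : (Fin d → ℤ) → ℝ)
    (hu : ∃ M : ℝ, ∀ α, |u α| ≤ M) (hv : ∃ M : ℝ, ∀ α, |v α| ≤ M) :
    ∀ α : Fin d → ℤ,
      Summable (fun β : Fin d → ℤ => Gw d dx μ α β * (A (u β) - A (v β))) ∧
      Summable (fun β : Fin d → ℤ => Gw d dx μ α β * |A (u β) - A (v β)|) ∧
      Real.sign (u α - v α) * ∑' β : Fin d → ℤ, Gw d dx μ α β * (A (u β) - A (v β)) ≤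
        ∑' β : Fin d → ℤ, Gw d dx μ α β * |A (u β) - A (v β)| := by
  intro α
  have hG : Summable (Gw d dx μ α) :=
    (summable_Glow hdx0 μ (measure_norm_gt_lt_top_s5 (by linarith) (by linarith) hμfin) α).add
      (summable_Gup hdx0 μ α)
  obtain ⟨C, hC⟩ := hA.exists_abs_comp_le hu
  obtain ⟨D, hD⟩ := hA.exists_abs_comp_le hv
  have hbd : ∀ β, |A (u β) - A (v β)| ≤ C + D := fun β =>
    (abs_sub _ _).trans (add_le_add (hC β) (hD β))
  have hsum : ∀ w : (Fin d → ℤ) → ℝ, (∀ β, |w β| ≤ C + D) →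
      Summable fun β => Gw d dx μ α β * w β := by
    intro w hw
    refine Summable.of_norm_bounded (hG.abs.mul_right (C + D)) fun β => ?_
    rw [Real.norm_eq_abs, abs_mul]
    exact mul_le_mul_of_nonneg_left (hw β) (abs_nonneg _)
  have h1 := hsum _ hbd
  have h2 := hsum (fun β => |A (u β) - A (v β)|) fun β => (abs_abs _).le.trans (hbd β)
  refine ⟨h1, h2, ?_⟩
  rw [← tsum_mul_left]
  refine (h1.mul_left _).tsum_le_tsum (fun β => ?_) h2
  rw [mul_left_comm]
  rcases eq_or_ne β α with rfl | hne
  · rw [hA.sign_sub_mul_sub]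
  · exact mul_le_mul_of_nonneg_left (sign_mul_le_abs _ _) (Gw_nonneg_of_ne hdx0 μ hne)
end
end
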